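/- Let f, g₁, …, g_p be real polynomials in m variables, let γ ∈ ℕ satisfy deg f ≤ 2γ and deg g_i ≤ 2β_i with β_i ≤ γ for each i. Suppose y : (Fin m →₀ ℕ) → ℝ is feasible for the order-γ moment relaxation (y_0 = 1, M_γ(y) positive semidefinite, M_{γ−β_i}(g_i y) positive semidefinite for every i), that rank M_γ(y) = 1, and that y is optimal, i.e., L_y(f) ≤ L_{y′}(f) for every feasible y′. Then there exists x* ∈ ℝ^m, given by x*_i = y_{e_i}, such that: y_α = (x*)^α for all |α| ≤ 2γ; g_i(x*) ≥ 0 for all i; f(x*) = L_y(f); and x* is a global minimizer, i.e., f(x*) ≤ f(x) for every x ∈ ℝ^m with g_i(x) ≥ 0 for all i. -/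

import Mathlib

open MvPolynomial

noncomputable section

/-- Total degree of an exponent vector `α ∈ (Fin m →₀ ℕ)`. -/
def degSum {m : ℕ} (α : Fin m →₀ ℕ) : ℕ := ∑ i, α i

/-- Index set of the order-`γ` moment matrix: exponent vectors of total degree at most `γ`. -/
def MomIdx (m γ : ℕ) : Type := {α : Fin m →₀ ℕ // degSum α ≤ γ}

instance momIdxFinite (m γ : ℕ) : Finite (MomIdx m γ) := by
  have h : ∀ (a : MomIdx m γ) (i : Fin m), a.1 i < γ + 1 := fun a i =>
    Nat.lt_succ_of_le (le_trans
      (Finset.single_le_sum (fun j _ => Nat.zero_le (a.1 j)) (Finset.mem_univ i)) a.2)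
  exact Finite.of_injective
    (fun a : MomIdx m γ => (fun i => (⟨a.1 i, h a i⟩ : Fin (γ + 1))))
    (fun a b hab => Subtype.ext (Finsupp.ext fun i =>
      congrArg Fin.val (congrFun hab i)))

instance momIdxFintype (m γ : ℕ) : Fintype (MomIdx m γ) := Fintype.ofFinite _

/-- The monomial `x^α = ∏ i, x i ^ α i`. -/
def monoEval {m : ℕ} (x : Fin m → ℝ) (α : Fin m →₀ ℕ) : ℝ := ∏ i, x i ^ α i

/-- The order-`γ` moment matrix of a moment sequence `y`. -/
def momMat {m : ℕ} (γ : ℕ) (y : (Fin m →₀ ℕ) → ℝ) :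
    Matrix (MomIdx m γ) (MomIdx m γ) ℝ :=
  Matrix.of fun a b => y (a.1 + b.1)

/-- The localizing matrix of a polynomial `g` with respect to a moment sequence `y`,
indexed by exponent vectors of total degree at most `η`. -/
def locMat {m : ℕ} (η : ℕ) (g : MvPolynomial (Fin m) ℝ) (y : (Fin m →₀ ℕ) → ℝ) :
    Matrix (MomIdx m η) (MomIdx m η) ℝ :=
  Matrix.of fun a b => ∑ δ ∈ g.support, g.coeff δ * y (a.1 + b.1 + δ)

/-- The linear functional `L_y` replacing each monomial of a polynomial by its moment. -/
def Lf {m : ℕ} (y : (Fin m →₀ ℕ) → ℝ) (f : MvPolynomial (Fin m) ℝ) : ℝ :=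
  ∑ α ∈ f.support, f.coeff α * y α

theorem degSum_zero {m : ℕ} : degSum (0 : Fin m →₀ ℕ) = 0 := by
  simp [degSum]

theorem degSum_add {m : ℕ} (a b : Fin m →₀ ℕ) : degSum (a + b) = degSum a + degSum b := by
  simp [degSum, Finset.sum_add_distrib]

theorem degSum_single_one {m : ℕ} (i : Fin m) : degSum (Finsupp.single i 1) = 1 := by
  simp [degSum]

theorem monoEval_zero {m : ℕ} (x : Fin m → ℝ) : monoEval x 0 = 1 := by
  simp [monoEval]

theorem monoEval_add {m : ℕ} (x : Fin m → ℝ) (a b : Fin m →₀ ℕ) :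
    monoEval x (a + b) = monoEval x a * monoEval x b := by
  simp [monoEval, pow_add, Finset.prod_mul_distrib]

theorem monoEval_single_one {m : ℕ} (x : Fin m → ℝ) (i : Fin m) :
    monoEval x (Finsupp.single i 1) = x i := by
  classical
  simp [monoEval, Finsupp.single_apply, pow_ite]

theorem exists_eq_single_one_add {m : ℕ} {α : Fin m →₀ ℕ} (h : α ≠ 0) :
    ∃ i α', α = Finsupp.single i 1 + α' := by
  obtain ⟨i, hi⟩ := Finsupp.ne_iff.mp h
  have hle : Finsupp.single i 1 ≤ α := by
    rw [Finsupp.single_le_iff]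
    exact Nat.one_le_iff_ne_zero.mpr hi
  exact ⟨i, α - Finsupp.single i 1, (add_tsub_cancel_of_le hle).symm⟩

/-- An exponent vector of degree at most `s + t` splits into pieces of degree at most `s`
and `t`. -/
theorem exists_add_of_degSum_le {m : ℕ} (s t : ℕ) (α : Fin m →₀ ℕ) (h : degSum α ≤ s + t) :
    ∃ a b, α = a + b ∧ degSum a ≤ s ∧ degSum b ≤ t := by
  induction s generalizing α with
  | zero => exact ⟨0, α, by simp, by simp [degSum_zero], by omega⟩
  | succ s ih =>
    by_cases hα : α = 0
    · exact ⟨0, 0, by simp [hα], by simp [degSum_zero], by simp [degSum_zero]⟩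
    · obtain ⟨i, α', rfl⟩ := exists_eq_single_one_add hα
      rw [degSum_add, degSum_single_one] at h
      obtain ⟨a, b, rfl, ha, hb⟩ := ih α' (by omega)
      refine ⟨Finsupp.single i 1 + a, b, by rw [add_assoc], ?_, hb⟩
      rw [degSum_add, degSum_single_one]
      omega

theorem degSum_le_totalDegree {m : ℕ} {f : MvPolynomial (Fin m) ℝ} {α : Fin m →₀ ℕ}
    (h : α ∈ f.support) : degSum α ≤ f.totalDegree := by
  have := le_totalDegree h
  rwa [Finsupp.sum_fintype _ _ fun _ => rfl] at this

theorem Lf_monoEval {m : ℕ} (x : Fin m → ℝ) (f : MvPolynomial (Fin m) ℝ) :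
    Lf (monoEval x) f = eval x f := by
  rw [eval_eq']
  rfl

theorem Lf_eq_eval {m k : ℕ} {y : (Fin m →₀ ℕ) → ℝ} {x : Fin m → ℝ}
    (hy : ∀ α, degSum α ≤ k → y α = monoEval x α) {f : MvPolynomial (Fin m) ℝ}
    (hf : f.totalDegree ≤ k) : Lf y f = eval x f := by
  rw [← Lf_monoEval]
  exact Finset.sum_congr rfl fun α hα => by rw [hy α ((degSum_le_totalDegree hα).trans hf)]

theorem momMat_monoEval {m : ℕ} (γ : ℕ) (x : Fin m → ℝ) :
    momMat γ (monoEval x) =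
      Matrix.vecMulVec (fun a : MomIdx m γ => monoEval x a.1)
        (star fun a : MomIdx m γ => monoEval x a.1) := by
  ext a b
  simp [momMat, Matrix.vecMulVec_apply, monoEval_add]

theorem locMat_monoEval {m : ℕ} (η : ℕ) (g : MvPolynomial (Fin m) ℝ) (x : Fin m → ℝ) :
    locMat η g (monoEval x) = eval x g • momMat η (monoEval x) := by
  ext a b
  simp only [locMat, momMat, Matrix.of_apply, Matrix.smul_apply, smul_eq_mul, ← Lf_monoEval, Lf,
    Finset.sum_mul]
  exact Finset.sum_congr rfl fun δ _ => by rw [monoEval_add x (a.1 + b.1) δ]; ring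

theorem momMat_monoEval_posSemidef {m : ℕ} (γ : ℕ) (x : Fin m → ℝ) :
    (momMat γ (monoEval x)).PosSemidef := by
  rw [momMat_monoEval]
  exact Matrix.posSemidef_vecMulVec_self_star _

theorem eval_nonneg_of_locMat_posSemidef {m k η : ℕ} {y : (Fin m →₀ ℕ) → ℝ} {x : Fin m → ℝ}
    (hy : ∀ α, degSum α ≤ k → y α = monoEval x α) {g : MvPolynomial (Fin m) ℝ}
    (hg : g.totalDegree ≤ k) (h : (locMat η g y).PosSemidef) : 0 ≤ eval x g := by
  have h00 : 0 ≤ ∑ δ ∈ g.support, g.coeff δ * y (0 + 0 + δ) :=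
    h.diag_nonneg (i := ⟨0, by simp [degSum_zero]⟩)
  rw [← Lf_eq_eval hy hg]
  simpa [Lf] using h00

/-- All two-by-two minors of a rank-one matrix vanish. -/
theorem Matrix.mul_apply_eq_of_rank_eq_one {ι κ K : Type*} [Fintype κ] [Field K]
    {A : Matrix ι κ K} (h : A.rank = 1) (i j : ι) (k l : κ) :
    A i k * A j l = A i l * A j k := by
  rw [Matrix.rank_eq_finrank_span_cols] at h
  obtain ⟨v, -, hv⟩ := finrank_eq_one_iff'.mp h
  have hcol : ∀ k, ∃ c : K, ∀ i, A i k = c * v.1 i := fun k => by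
    obtain ⟨c, hc⟩ := hv ⟨A.col k, Submodule.subset_span ⟨k, rfl⟩⟩
    exact ⟨c, fun i => (congrFun (congrArg Subtype.val hc) i).symm⟩
  obtain ⟨c, hc⟩ := hcol k
  obtain ⟨d, hd⟩ := hcol l
  rw [hc, hc, hd, hd]
  ring

theorem moment_add_of_rank_momMat_eq_one {m γ : ℕ} {y : (Fin m →₀ ℕ) → ℝ} (hy0 : y 0 = 1)
    (h : (momMat γ y).rank = 1) (a b : Fin m →₀ ℕ) (ha : degSum a ≤ γ) (hb : degSum b ≤ γ) :
    y (a + b) = y a * y b := by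
  have h0 : degSum (0 : Fin m →₀ ℕ) ≤ γ := by simp [degSum_zero]
  have hminor : y (a + b) * y (0 + 0) = y (a + 0) * y (0 + b) :=
    Matrix.mul_apply_eq_of_rank_eq_one h ⟨a, ha⟩ ⟨0, h0⟩ ⟨b, hb⟩ ⟨0, h0⟩
  simpa [hy0] using hminor

theorem moment_eq_monoEval_of_rank_momMat_eq_one {m γ : ℕ} {y : (Fin m →₀ ℕ) → ℝ}
    (hy0 : y 0 = 1) (h : (momMat γ y).rank = 1) (α : Fin m →₀ ℕ) (hα : degSum α ≤ 2 * γ) :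
    y α = monoEval (fun i => y (Finsupp.single i 1)) α := by
  have hmul := moment_add_of_rank_momMat_eq_one hy0 h
  have hlow : ∀ n ≤ γ, ∀ a : Fin m →₀ ℕ, degSum a ≤ n →
      y a = monoEval (fun i => y (Finsupp.single i 1)) a := by
    intro n
    induction n with
    | zero =>
      intro _ a ha
      by_cases h0 : a = 0
      · rw [h0, hy0, monoEval_zero]
      · obtain ⟨i, a', rfl⟩ := exists_eq_single_one_add h0
        rw [degSum_add, degSum_single_one] at ha
        omega
    | succ n ih =>
      intro hn a ha
      by_cases h0 : a = 0
      · rw [h0, hy0, monoEval_zero]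
      · obtain ⟨i, a', rfl⟩ := exists_eq_single_one_add h0
        rw [degSum_add, degSum_single_one] at ha
        rw [hmul _ _ (by rw [degSum_single_one]; omega) (by omega), monoEval_add,
          monoEval_single_one, ih (by omega) a' (by omega)]
  obtain ⟨a, b, rfl, ha, hb⟩ := exists_add_of_degSum_le γ γ α (by omega)
  rw [hmul a b ha hb, monoEval_add, hlow γ le_rfl a ha, hlow γ le_rfl b hb]

/-- if `y` is feasible and optimal for the order-`γ` moment relaxation and
its moment matrix has rank one, then the point `x*` given by the first-order moments
satisfies `y_α = (x*)^α` for `|α| ≤ 2γ`, is feasible for the polynomial optimization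
problem, attains the relaxation objective value, and is a global minimizer. -/
theorem rank_one_optimal_moment_relaxation_gives_global_solution
    (m p γ : ℕ) (f : MvPolynomial (Fin m) ℝ) (g : Fin p → MvPolynomial (Fin m) ℝ)
    (β : Fin p → ℕ) (hf : f.totalDegree ≤ 2 * γ)
    (hg : ∀ i, (g i).totalDegree ≤ 2 * β i) (hβ : ∀ i, β i ≤ γ)
    (y : (Fin m →₀ ℕ) → ℝ) (hy0 : y 0 = 1)
    (hpsd : (momMat γ y : Matrix (MomIdx m γ) (MomIdx m γ) ℝ).PosSemidef)
    (hloc : ∀ i, (locMat (γ - β i) (g i) y :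
        Matrix (MomIdx m (γ - β i)) (MomIdx m (γ - β i)) ℝ).PosSemidef)
    (hrank : (momMat γ y : Matrix (MomIdx m γ) (MomIdx m γ) ℝ).rank = 1)
    (hopt : ∀ y' : (Fin m →₀ ℕ) → ℝ, y' 0 = 1 →
      (momMat γ y' : Matrix (MomIdx m γ) (MomIdx m γ) ℝ).PosSemidef →
      (∀ i, (locMat (γ - β i) (g i) y' :
          Matrix (MomIdx m (γ - β i)) (MomIdx m (γ - β i)) ℝ).PosSemidef) →
      Lf y f ≤ Lf y' f) :
    ∃ xstar : Fin m → ℝ,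
      (∀ i, xstar i = y (Finsupp.single i 1)) ∧
      (∀ α : Fin m →₀ ℕ, degSum α ≤ 2 * γ → y α = monoEval xstar α) ∧
      (∀ i, 0 ≤ MvPolynomial.eval xstar (g i)) ∧
      MvPolynomial.eval xstar f = Lf y f ∧
      (∀ x : Fin m → ℝ, (∀ i, 0 ≤ MvPolynomial.eval x (g i)) →
        MvPolynomial.eval xstar f ≤ MvPolynomial.eval x f) := by
  have hy := moment_eq_monoEval_of_rank_momMat_eq_one hy0 hrank
  have hLf := Lf_eq_eval hy hf
  refine ⟨fun i => y (Finsupp.single i 1), fun _ => rfl, hy, fun i => ?_, hLf.symm,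
    fun x hx => ?_⟩
  · exact eval_nonneg_of_locMat_posSemidef hy
      ((hg i).trans (Nat.mul_le_mul_left 2 (hβ i))) (hloc i)
  · rw [← hLf, ← Lf_monoEval x f]
    refine hopt _ (monoEval_zero x) (momMat_monoEval_posSemidef γ x) fun i => ?_
    rw [locMat_monoEval]
    exact (momMat_monoEval_posSemidef _ x).smul (hx i)
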